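/- arXiv:2201.06617 — 3 statements merged into one kernel-verified Lean document; each statement's English description precedes it below -/
import Mathlib

section
/- Let h₁, h₂, k be positive integers with h₁ < k, h₂ < k and k ≤ h₁ + h₂ + 1, and set i = h₁ + h₂ + 1 − k. Let A be an (h₁+1)×(k+1) complex matrix of rank h₁+1 and B an (h₂+1)×(k+1) complex matrix of rank h₂+1, and assume the centers C₁ = ker(A) and C₂ = ker(B) (kernels of x ↦ Ax and x ↦ Bx on ℂ^{k+1}) satisfy C₁ ∩ C₂ = {0}. Fix a profile (α₁, α₂), i.e. integers with 1 ≤ αⱼ ≤ hⱼ and α₁ + α₂ = k + 1, and set sⱼ = hⱼ − αⱼ, so that (s₁+1) + (s₂+1) = i. Define the matrix F whose rows are indexed by the subsets I of the column-index set of Aᵀ (of size h₁+1) with |I| = s₁+1, whose columns are indexed by the subsets J of the column-index set of Bᵀ (of size h₂+1) with |J| = s₂+1, and whose (I,J)-entry is the determinant of the (k+1)×(k+1) matrix whose first α₁ columns are the columns of Aᵀ indexed by the complement of I (in increasing order) and whose last α₂ columns are the columns of Bᵀ indexed by the complement of J (in increasing order). Then rank(F) = binom((h₁−α₁+1) + (h₂−α₂+1),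 h₁−α₁+1) = binom(i, s₁+1). -/
open Matrix

namespace BifocalAux
open Set.powersetCard

/-- The bilinear pairing of exterior powers induced by an alternating form. -/
lemma exists_pairing {K X Y W : Type*} [Field K] [AddCommGroup X] [Module K X]
    [AddCommGroup Y] [Module K Y] [AddCommGroup W] [Module K W] (p q : ℕ)
    (d : W [⋀^Fin (p + q)]→ₗ[K] K) (a : X →ₗ[K] W) (b : Y →ₗ[K] W) :
    ∃ β : (⋀[K]^p X) →ₗ[K] (⋀[K]^q Y) →ₗ[K] K, ∀ (u : Fin p → X) (v : Fin q → Y),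
      β (exteriorPower.ιMulti K p u) (exteriorPower.ιMulti K q v) =
        d (Fin.append (a ∘ u) (b ∘ v)) := by
  classical
  let D : ExteriorAlgebra K W →ₗ[K] K := ExteriorAlgebra.liftAlternating
    (Function.update (fun _ => 0) (p + q) d : ∀ i, W [⋀^Fin i]→ₗ[K] K)
  refine ⟨((LinearMap.mul K (ExteriorAlgebra K W)).compr₂ D).compl₁₂
    ((⋀[K]^p W).subtype ∘ₗ exteriorPower.map p a)
    ((⋀[K]^q W).subtype ∘ₗ exteriorPower.map q b), fun u v => ?_⟩
  have h : (ExteriorAlgebra.ιMulti K p (a ∘ u)) * (ExteriorAlgebra.ιMulti K q (b ∘ v)) =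
      ExteriorAlgebra.ιMulti K (p + q) (Fin.append (a ∘ u) (b ∘ v)) := by
    simp only [ExteriorAlgebra.ιMulti_apply]
    change _ = (List.ofFn ((ExteriorAlgebra.ι K) ∘ Fin.append (a ∘ u) (b ∘ v))).prod
    rw [← List.map_ofFn, List.ofFn_fin_append, List.map_append, List.prod_append]
    simp only [List.map_ofFn]
    congr
  simp only [LinearMap.compl₁₂_apply, LinearMap.compr₂_apply, LinearMap.comp_apply,
    exteriorPower.map_apply_ιMulti, Submodule.subtype_apply, exteriorPower.ιMulti_apply_coe,
    LinearMap.mul_apply', h]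
  simp [D, ExteriorAlgebra.liftAlternating_apply_ιMulti]

lemma rank_toMatrix₂_le {K M N ι ι' κ κ' : Type*} [Field K] [AddCommGroup M] [Module K M]
    [AddCommGroup N] [Module K N] [Fintype ι] [Fintype ι'] [Fintype κ] [Fintype κ']
    (β : M →ₗ[K] N →ₗ[K] K) (b : Module.Basis ι K M) (b' : Module.Basis ι' K M)
    (c : Module.Basis κ K N) (c' : Module.Basis κ' K N) :
    (Matrix.of fun i j => β (b' i) (c' j)).rank ≤ (Matrix.of fun i j => β (b i) (c j)).rank := by
  classical
  have h := LinearMap.toMatrix₂_mul_basis_toMatrix b c b' c' β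
  have e1 : LinearMap.toMatrix₂ b c β = Matrix.of fun i j => β (b i) (c j) := by
    ext; simp [LinearMap.toMatrix₂_apply]
  have e2 : LinearMap.toMatrix₂ b' c' β = Matrix.of fun i j => β (b' i) (c' j) := by
    ext; simp [LinearMap.toMatrix₂_apply]
  rw [← e1, ← e2, ← h]
  exact (Matrix.rank_mul_le_left _ _).trans (Matrix.rank_mul_le_right _ _)

lemma card_inter {ι : Type*} [Fintype ι] [DecidableEq ι] {m n : ℕ}
    (φ : Fin m ↪ ι) (ψ : Fin n ↪ ι) (hs : ∀ x, x ∈ Set.range φ ∨ x ∈ Set.range ψ) :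
    (Finset.univ.filter fun x : Fin m => φ x ∈ Finset.univ.map ψ).card
      = m + n - Fintype.card ι := by
  have h1 : (Finset.univ.filter fun x : Fin m => φ x ∈ Finset.univ.map ψ).map φ
      = Finset.univ.map φ ∩ Finset.univ.map ψ := by
    ext x
    simp only [Finset.mem_map, Finset.mem_filter, Finset.mem_inter, Finset.mem_univ, true_and]
    aesop
  have h2 := Finset.card_union_add_card_inter (Finset.univ.map φ) (Finset.univ.map ψ)
  have h3 : Finset.univ.map φ ∪ Finset.univ.map ψ = Finset.univ := by
    ext x; simpa using hs x
  rw [h3, ← h1] at h2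
  simp at h2 ⊢
  omega

lemma rank_comb {K ι : Type*} [Field K] [Fintype ι] [DecidableEq ι] {m n p q : ℕ}
    (φ : Fin m ↪ ι) (ψ : Fin n ↪ ι) (hs : ∀ x, x ∈ Set.range φ ∨ x ∈ Set.range ψ)
    (hc : Fintype.card ι = p + q) (hp : p ≤ m)
    (M : Matrix (Set.powersetCard (Fin m) p) (Set.powersetCard (Fin n) q) K)
    (hM : ∀ S T, M S T ≠ 0 ↔ Disjoint (S.1.map φ) (T.1.map ψ)) :
    M.rank = (m + n - Fintype.card ι).choose (m - p) := by
  classical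
  have hM' : ∀ S T, M S T ≠ 0 ↔ T.1.map ψ = (S.1.map φ)ᶜ := by
    intro S T
    rw [hM]
    constructor
    · intro h
      apply Finset.eq_of_subset_of_card_le
      · rw [Finset.subset_compl_iff_disjoint_right]; exact h.symm
      · rw [Finset.card_compl, Finset.card_map, Finset.card_map, hc]
        have := S.2; have := T.2
        simp only [Set.powersetCard.mem_iff] at *
        omega
    · intro h; rw [h]; exact disjoint_compl_right
  set E := Finset.univ.filter fun x : Fin m => φ x ∈ Finset.univ.map ψ with hE
  set P : Finset (Set.powersetCard (Fin m) p) := Finset.univ.filter fun S => (S.1)ᶜ ⊆ E with hP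
  have hPcard : P.card = (m + n - Fintype.card ι).choose (m - p) := by
    rw [← card_inter φ ψ hs, ← Finset.card_powersetCard]
    refine Finset.card_bij (fun S _ => (S.1)ᶜ) ?_ ?_ ?_
    · intro S hS
      rw [Finset.mem_powersetCard]
      refine ⟨(Finset.mem_filter.1 hS).2, ?_⟩
      rw [Finset.card_compl, Fintype.card_fin]
      have := S.2
      rw [Set.powersetCard.mem_iff] at this
      omega
    · intro S _ T _ h
      exact Subtype.ext (compl_injective h)
    · intro T hT
      rw [Finset.mem_powersetCard] at hT
      refine ⟨⟨Tᶜ, ?_⟩, ?_, by simp⟩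
      · rw [Set.powersetCard.mem_iff, Finset.card_compl, Fintype.card_fin, hT.2]; omega
      · simp only [hP, Finset.mem_filter, Finset.mem_univ, true_and, compl_compl]
        exact hT.1
  rw [← hPcard]
  apply le_antisymm
  · apply Matrix.rank_le_card_of_support_subset
    intro S hS
    obtain ⟨T, hT⟩ : ∃ T, M S T ≠ 0 := by
      by_contra! hcon
      exact hS (funext hcon)
    have hT := (hM' S T).1 hT
    simp only [hP, Finset.coe_filter, Finset.mem_univ, true_and, Set.mem_ofPred_eq]
    intro x hx
    simp only [hE, Finset.mem_filter, Finset.mem_univ, true_and]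
    have : φ x ∈ T.1.map ψ := by
      rw [hT]; simpa using hx
    exact Finset.map_subset_map.2 (Finset.subset_univ _) this
  · have hg : ∀ S : P, ∃ T, M S.1 T ≠ 0 := by
      rintro ⟨S, hS⟩
      have hS := (Finset.mem_filter.1 hS).2
      have key : (Finset.univ.filter fun y : Fin n => ψ y ∈ (S.1.map φ)ᶜ).map ψ
          = (S.1.map φ)ᶜ := by
        ext x
        constructor
        · intro hx
          obtain ⟨y, hy, rfl⟩ := Finset.mem_map.1 hx
          exact (Finset.mem_filter.1 hy).2
        · intro hx
          have : x ∈ Set.range ψ := by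
            rcases hs x with ⟨z, rfl⟩ | h
            · have hz : z ∈ (S.1)ᶜ := by simpa using hx
              have := (Finset.mem_filter.1 (hS hz)).2
              simpa using this
            · exact h
          obtain ⟨y, rfl⟩ := this
          exact Finset.mem_map_of_mem _ (Finset.mem_filter.2 ⟨Finset.mem_univ _, hx⟩)
      refine ⟨⟨Finset.univ.filter fun y : Fin n => ψ y ∈ (S.1.map φ)ᶜ, ?_⟩, (hM' _ _).2 key⟩
      rw [Set.powersetCard.mem_iff, ← Finset.card_map ψ, key, Finset.card_compl, Finset.card_map,
        Set.powersetCard.mem_iff.1 S.2, hc]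
      omega
    choose g hg using hg
    have hd : M.submatrix (fun S : P => S.1) g = Matrix.diagonal fun S : P => M S.1 (g S) := by
      ext S S'
      by_cases h : S = S'
      · subst h; simp
      · rw [Matrix.diagonal_apply_ne _ h, Matrix.submatrix_apply]
        by_contra hne
        have h1 := (hM' _ _).1 hne
        have h2 := (hM' _ _).1 (hg S')
        rw [h1] at h2
        exact h (Subtype.ext (Subtype.ext (Finset.map_injective φ (compl_injective h2))))
    have h1 := Matrix.rank_submatrix_le M (fun S : P => S.1) g
    rw [hd, Matrix.rank_of_det_ne_zero] at h1
    · simpa using h1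
    · rw [Matrix.det_diagonal, Finset.prod_ne_zero_iff]
      exact fun S _ => hg S

lemma exists_bases_side {K W : Type*} [Field K] [AddCommGroup W] [Module K W]
    {m : ℕ} (a : (Fin m → K) →ₗ[K] W) (ha : Function.Injective a)
    (t : Set W) (ht : t ⊆ LinearMap.range a) (hspan : (LinearMap.range a : Set W) ⊆ Submodule.span K t)
    (hli : LinearIndepOn K id t) :
    ∃ (c : Module.Basis (Fin m) K (Fin m → K)) (e : Fin m ≃ t), ∀ i, a (c i) = e i := by
  have hsp : Submodule.span K t = LinearMap.range a :=
    le_antisymm (Submodule.span_le.2 ht) hspan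
  choose x hx using fun i : t => ht i.2
  have hxli : LinearIndependent K x := by
    apply LinearIndependent.of_comp a
    have hax : a ∘ x = fun i : t => id (i : W) := funext hx
    rw [hax]
    exact hli
  let bx : Module.Basis t K (Fin m → K) := Module.Basis.mk hxli (by
    intro v _
    have hv : a v ∈ Submodule.span K (Set.range (a ∘ x)) := by
      have : Set.range (a ∘ x) = t := by
        ext w; constructor
        · rintro ⟨i, rfl⟩; simp [hx]
        · intro hw; exact ⟨⟨w, hw⟩, hx _⟩
      rw [this, hsp]; exact ⟨v, rfl⟩
    rw [Set.range_comp, Submodule.span_image] at hv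
    obtain ⟨v', hv', h⟩ := hv
    exact ha h ▸ hv')
  let e : Fin m ≃ t := (Pi.basisFun K (Fin m)).indexEquiv bx
  refine ⟨bx.reindex e.symm, e, fun i => ?_⟩
  simp [bx, hx]

lemma exists_bases.{u} {K : Type*} {W : Type u} [Field K] [AddCommGroup W] [Module K W] [FiniteDimensional K W]
    {m n : ℕ} (a : (Fin m → K) →ₗ[K] W) (ha : Function.Injective a)
    (b : (Fin n → K) →ₗ[K] W) (hb : Function.Injective b)
    (htop : LinearMap.range a ⊔ LinearMap.range b = ⊤) :
    ∃ (ι : Type u) (_ : Fintype ι) (w : Module.Basis ι K W)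
      (c : Module.Basis (Fin m) K (Fin m → K)) (c' : Module.Basis (Fin n) K (Fin n → K))
      (φ : Fin m ↪ ι) (ψ : Fin n ↪ ι), (∀ i, a (c i) = w (φ i)) ∧ (∀ i, b (c' i) = w (ψ i)) ∧
      ∀ x, x ∈ Set.range φ ∨ x ∈ Set.range ψ := by
  classical
  set U := LinearMap.range a
  set V := LinearMap.range b
  obtain ⟨s, hsU, -, hs1, hs⟩ := exists_linearIndepOn_id_extension (K := K) (s := ∅)
    (t := ((U ⊓ V : Submodule K W) : Set W)) (linearIndepOn_empty K id) (Set.empty_subset _)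
  obtain ⟨t, htU, hst, ht1, ht⟩ := exists_linearIndepOn_id_extension hs
    (t := (U : Set W)) (fun x hx => (hsU hx).1)
  obtain ⟨t', htV, hst', ht1', ht'⟩ := exists_linearIndepOn_id_extension hs
    (t := (V : Set W)) (fun x hx => (hsU hx).2)
  obtain ⟨c, e, he⟩ := exists_bases_side a ha t htU ht1 ht
  obtain ⟨c', e', he'⟩ := exists_bases_side b hb t' htV ht1' ht'
  have fs : s.Finite := hs.finite
  have ft : t.Finite := ht.finite
  have ft' : t'.Finite := ht'.finite
  have : Fintype ↥(t ∪ t') := (ft.union ft').fintype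
  have spS : Submodule.span K s = U ⊓ V := le_antisymm (Submodule.span_le.2 hsU) hs1
  have spT : Submodule.span K t = U := le_antisymm (Submodule.span_le.2 htU) ht1
  have spT' : Submodule.span K t' = V := le_antisymm (Submodule.span_le.2 htV) ht1'
  have cS : Module.finrank K ↥(U ⊓ V) = s.ncard := by
    have := fs.fintype
    rw [← spS, finrank_span_set_eq_card hs, Set.ncard_eq_toFinset_card']
  have cT : Module.finrank K U = t.ncard := by
    have := ft.fintype
    rw [← spT, finrank_span_set_eq_card ht, Set.ncard_eq_toFinset_card']
  have cT' : Module.finrank K V = t'.ncard := by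
    have := ft'.fintype
    rw [← spT', finrank_span_set_eq_card ht', Set.ncard_eq_toFinset_card']
  have hdim := Submodule.finrank_sup_add_finrank_inf_eq U V
  rw [htop, finrank_top, cS, cT, cT'] at hdim
  have hcard := Set.ncard_union_add_ncard_inter t t' ft ft'
  have hle : s.ncard ≤ (t ∩ t').ncard :=
    Set.ncard_le_ncard (Set.subset_inter hst hst') (ft.inter_of_left _)
  have hι : Fintype.card ↥(t ∪ t') = (t ∪ t').ncard := by
    rw [← Nat.card_coe_set_eq, Nat.card_eq_fintype_card]
  have hsp : ⊤ ≤ Submodule.span K (Set.range (Subtype.val : ↥(t ∪ t') → W)) := by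
    rw [Subtype.range_coe, Submodule.span_union, spT, spT', htop]
  have hli : LinearIndependent K (Subtype.val : ↥(t ∪ t') → W) :=
    linearIndependent_of_top_le_span_of_card_le_finrank hsp (le_of_eq_of_le hι (by omega))
  refine ⟨↥(t ∪ t'), inferInstance, Module.Basis.mk hli hsp, c, c',
    ⟨fun i => ⟨e i, Set.mem_union_left _ (e i).2⟩, fun i j h => e.injective (Subtype.ext (Subtype.ext_iff.1 h :))⟩,
    ⟨fun i => ⟨e' i, Set.mem_union_right _ (e' i).2⟩, fun i j h => e'.injective (Subtype.ext (Subtype.ext_iff.1 h :))⟩,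
    ?_, ?_, ?_⟩
  · intro i; rw [he, Module.Basis.mk_apply]; rfl
  · intro i; rw [he', Module.Basis.mk_apply]; rfl
  · rintro ⟨x, hx | hx⟩
    · left; exact ⟨e.symm ⟨x, hx⟩, Subtype.ext (Subtype.ext_iff.1 (e.apply_symm_apply ⟨x, hx⟩) :)⟩
    · right; exact ⟨e'.symm ⟨x, hx⟩, Subtype.ext (Subtype.ext_iff.1 (e'.apply_symm_apply ⟨x, hx⟩) :)⟩

lemma rank_main {K W : Type*} [Field K] [AddCommGroup W] [Module K W] [FiniteDimensional K W]
    {m n p q : ℕ} (d : W [⋀^Fin (p + q)]→ₗ[K] K) (hd : ∀ v, d v ≠ 0 ↔ LinearIndependent K v)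
    (hW : Module.finrank K W = p + q) (hp : p ≤ m)
    (a : (Fin m → K) →ₗ[K] W) (ha : Function.Injective a)
    (b : (Fin n → K) →ₗ[K] W) (hb : Function.Injective b)
    (htop : LinearMap.range a ⊔ LinearMap.range b = ⊤) :
    (Matrix.of fun (S : Set.powersetCard (Fin m) p) (T : Set.powersetCard (Fin n) q) =>
      d (Fin.append (fun i => a (Pi.single (ofFinEmbEquiv.symm S i) 1))
        (fun j => b (Pi.single (ofFinEmbEquiv.symm T j) 1)))).rank
      = (m + n - (p + q)).choose (m - p) := by
  classical
  obtain ⟨ι, _, w, c, c', φ, ψ, hφ, hψ, hs⟩ := exists_bases a ha b hb htop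
  obtain ⟨β, hβ⟩ := exists_pairing p q d a b
  have hι : Fintype.card ι = p + q := by rw [← hW, Module.finrank_eq_card_basis w]
  have h2 := rank_comb (K := K) (p := p) (q := q) φ ψ hs hι hp
    (Matrix.of fun S T => β (c.exteriorPower p S) (c'.exteriorPower q T)) ?_
  · rw [hι] at h2
    rw [← h2]
    have e1 : (Matrix.of fun (S : Set.powersetCard (Fin m) p) (T : Set.powersetCard (Fin n) q) =>
      d (Fin.append (fun i => a (Pi.single (ofFinEmbEquiv.symm S i) 1))
        (fun j => b (Pi.single (ofFinEmbEquiv.symm T j) 1)))) =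
      Matrix.of fun S T => β ((Pi.basisFun K (Fin m)).exteriorPower p S)
        ((Pi.basisFun K (Fin n)).exteriorPower q T) := by
      ext S T
      simp only [Matrix.of_apply, exteriorPower.basis_apply, exteriorPower.ιMulti_family, hβ]
      congr 2
      · ext i; simp
      · ext i; simp
    rw [e1]
    exact le_antisymm (rank_toMatrix₂_le _ _ _ _ _) (rank_toMatrix₂_le _ _ _ _ _)
  · intro S T
    simp only [Matrix.of_apply, exteriorPower.basis_apply, exteriorPower.ιMulti_family, hβ]
    rw [hd]
    have e : Fin.append (a ∘ c ∘ (ofFinEmbEquiv.symm S)) (b ∘ c' ∘ (ofFinEmbEquiv.symm T))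
        = w ∘ Fin.append (φ ∘ (ofFinEmbEquiv.symm S)) (ψ ∘ (ofFinEmbEquiv.symm T)) := by
      ext i
      refine Fin.addCases (fun i => ?_) (fun i => ?_) i
      · simp [hφ]
      · simp [hψ]
    rw [e]
    trans Function.Injective
      (Fin.append (φ ∘ (ofFinEmbEquiv.symm S)) (ψ ∘ (ofFinEmbEquiv.symm T)))
    · exact ⟨fun h => Function.Injective.of_comp h.injective, fun h => w.linearIndependent.comp _ h⟩
    rw [Fin.append_injective_iff]
    constructor
    · rintro ⟨-, -, h⟩
      rw [Finset.disjoint_left]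
      intro x hx hx'
      obtain ⟨y, hy, rfl⟩ := Finset.mem_map.1 hx
      obtain ⟨z, hz, hzy⟩ := Finset.mem_map.1 hx'
      obtain ⟨i, rfl⟩ := (mem_range_ofFinEmbEquiv_symm_iff_mem S y).2 hy
      obtain ⟨j, rfl⟩ := (mem_range_ofFinEmbEquiv_symm_iff_mem T z).2 hz
      exact h i j hzy.symm
    · intro h
      refine ⟨φ.injective.comp (RelEmbedding.injective _),
        ψ.injective.comp (RelEmbedding.injective _), fun i j hij => ?_⟩
      refine Finset.disjoint_left.1 h
        (Finset.mem_map_of_mem φ ((mem_range_ofFinEmbEquiv_symm_iff_mem S _).1 ⟨i, rfl⟩)) ?_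
      have hij' : φ (ofFinEmbEquiv.symm S i) = ψ (ofFinEmbEquiv.symm T j) := hij
      rw [hij']
      exact Finset.mem_map_of_mem ψ ((mem_range_ofFinEmbEquiv_symm_iff_mem T _).1 ⟨j, rfl⟩)

lemma injective_transpose {m n : ℕ} (A : Matrix (Fin m) (Fin n) ℂ) (hA : A.rank = m) :
    Function.Injective Aᵀ.mulVecLin := by
  rw [← LinearMap.ker_eq_bot, ← Submodule.finrank_eq_zero]
  have h := LinearMap.finrank_range_add_finrank_ker Aᵀ.mulVecLin
  have h2 : Module.finrank ℂ (LinearMap.range Aᵀ.mulVecLin) = m := by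
    exact (Matrix.rank_transpose A).trans hA
  rw [h2] at h
  simp at h
  simpa using h

lemma range_sup {m n k : ℕ} (A : Matrix (Fin m) (Fin k) ℂ) (B : Matrix (Fin n) (Fin k) ℂ)
    (hker : LinearMap.ker A.mulVecLin ⊓ LinearMap.ker B.mulVecLin = ⊥) :
    LinearMap.range Aᵀ.mulVecLin ⊔ LinearMap.range Bᵀ.mulVecLin = ⊤ := by
  by_contra hne
  obtain ⟨f, hf, hle⟩ := Submodule.exists_le_ker_of_lt_top _ (lt_top_iff_ne_top.2 hne)
  have key : ∀ v : Fin k → ℂ, f v = ∑ i, v i * f (Pi.single i 1) := by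
    intro v
    conv_lhs => rw [pi_eq_sum_univ' v]
    simp [map_sum]
  have hx : ∀ {l : ℕ} (C : Matrix (Fin l) (Fin k) ℂ),
      LinearMap.range Cᵀ.mulVecLin ≤ LinearMap.ker f →
      (fun i => f (Pi.single i 1)) ∈ LinearMap.ker C.mulVecLin := by
    intro l C hC
    rw [LinearMap.mem_ker]
    ext r
    have h1 : f (Cᵀ.mulVecLin (Pi.single r 1)) = 0 := hC ⟨_, rfl⟩
    rw [key] at h1
    simpa [Matrix.mulVec, dotProduct] using h1
  have : (fun i => f (Pi.single i 1)) ∈ LinearMap.ker A.mulVecLin ⊓ LinearMap.ker B.mulVecLin :=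
    ⟨hx A (le_sup_left.trans hle), hx B (le_sup_right.trans hle)⟩
  rw [hker, Submodule.mem_bot] at this
  apply hf
  ext v
  have := congrFun this
  simp_all

end BifocalAux

/-- The rank of a bifocal Grassmann tensor with profile `(α₁, α₂)` is
`binom((h₁-α₁+1)+(h₂-α₂+1), h₁-α₁+1) = binom(i, s₁+1)` where `i = h₁+h₂+1-k`. -/
theorem rank_bifocal_grassmann_tensor
    (h₁ h₂ k : ℕ) (hh₁ : 0 < h₁) (hh₂ : 0 < h₂)
    (hk1 : h₁ < k) (hk2 : h₂ < k) (hk3 : k ≤ h₁ + h₂ + 1)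
    (A : Matrix (Fin (h₁ + 1)) (Fin (k + 1)) ℂ)
    (B : Matrix (Fin (h₂ + 1)) (Fin (k + 1)) ℂ)
    (hA : A.rank = h₁ + 1) (hB : B.rank = h₂ + 1)
    (hker : LinearMap.ker A.mulVecLin ⊓ LinearMap.ker B.mulVecLin = ⊥)
    (α₁ α₂ : ℕ) (hα₁ : 1 ≤ α₁) (hα₁' : α₁ ≤ h₁) (hα₂ : 1 ≤ α₂) (hα₂' : α₂ ≤ h₂)
    (hsum : α₁ + α₂ = k + 1)
    (F : Matrix {I : Finset (Fin (h₁ + 1)) // I.card = (h₁ - α₁) + 1}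
                {J : Finset (Fin (h₂ + 1)) // J.card = (h₂ - α₂) + 1} ℂ)
    (hF : ∀ (I : {I : Finset (Fin (h₁ + 1)) // I.card = (h₁ - α₁) + 1})
            (J : {J : Finset (Fin (h₂ + 1)) // J.card = (h₂ - α₂) + 1}),
      F I J = Matrix.det (Matrix.of fun (r c : Fin (k + 1)) =>
        Sum.elim
          (fun a : Fin α₁ => Aᵀ r ((I.1ᶜ).orderEmbOfFin
            (by rw [Finset.card_compl, I.2, Fintype.card_fin]; omega) a))
          (fun b : Fin α₂ => Bᵀ r ((J.1ᶜ).orderEmbOfFin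
            (by rw [Finset.card_compl, J.2, Fintype.card_fin]; omega) b))
          ((finCongr hsum.symm).trans finSumFinEquiv.symm c))) :
    F.rank = Nat.choose ((h₁ - α₁ + 1) + (h₂ - α₂ + 1)) (h₁ - α₁ + 1) ∧
      Nat.choose ((h₁ - α₁ + 1) + (h₂ - α₂ + 1)) (h₁ - α₁ + 1) =
        Nat.choose (h₁ + h₂ + 1 - k) (h₁ - α₁ + 1) := by
  have hcomp1 : α₁ + (h₁ - α₁ + 1) = Fintype.card (Fin (h₁ + 1)) := by
    rw [Fintype.card_fin]; omega
  have hcomp2 : α₂ + (h₂ - α₂ + 1) = Fintype.card (Fin (h₂ + 1)) := by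
    rw [Fintype.card_fin]; omega
  have hi : (h₁ - α₁ + 1) + (h₂ - α₂ + 1) = h₁ + h₂ + 1 - k := by omega
  refine ⟨?_, by rw [hi]⟩
  let d : (Fin (k + 1) → ℂ) [⋀^Fin (α₁ + α₂)]→ₗ[ℂ] ℂ :=
    (Matrix.detRowAlternating (n := Fin (k + 1)) (R := ℂ)).domDomCongr (finCongr hsum.symm)
  have hd' : ∀ v, d v = Matrix.det (Matrix.of (v ∘ finCongr hsum.symm)) := fun v => rfl
  have hd : ∀ v, d v ≠ 0 ↔ LinearIndependent ℂ v := by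
    intro v
    rw [hd', ← isUnit_iff_ne_zero, ← Matrix.isUnit_iff_isUnit_det,
      ← Matrix.linearIndependent_rows_iff_isUnit]
    exact linearIndependent_equiv (finCongr hsum.symm)
  have hmain := BifocalAux.rank_main (m := h₁ + 1) (n := h₂ + 1) d hd (by simp [hsum]) (by omega)
    Aᵀ.mulVecLin (BifocalAux.injective_transpose A hA)
    Bᵀ.mulVecLin (BifocalAux.injective_transpose B hB) (BifocalAux.range_sup A B hker)
  have e1 : h₁ + 1 + (h₂ + 1) - (α₁ + α₂) = (h₁ - α₁ + 1) + (h₂ - α₂ + 1) := by omega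
  have e2 : h₁ + 1 - α₁ = h₁ - α₁ + 1 := by omega
  rw [e1, e2] at hmain
  rw [← hmain]
  let E1 : {I : Finset (Fin (h₁ + 1)) // I.card = (h₁ - α₁) + 1} ≃
      Set.powersetCard (Fin (h₁ + 1)) α₁ := Set.powersetCard.compl hcomp1
  let E2 : {J : Finset (Fin (h₂ + 1)) // J.card = (h₂ - α₂) + 1} ≃
      Set.powersetCard (Fin (h₂ + 1)) α₂ := Set.powersetCard.compl hcomp2
  rw [← Matrix.rank_submatrix _ E1 E2]
  congr 1
  ext I J
  rw [hF, Matrix.submatrix_apply, Matrix.of_apply, hd', ← Matrix.det_transpose]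
  congr 1
  ext c r
  simp only [Matrix.transpose_apply, Matrix.of_apply, Function.comp_apply, Equiv.trans_apply]
  generalize (finCongr hsum.symm) c = c'
  refine Fin.addCases (fun a => ?_) (fun b => ?_) c'
  · rw [finSumFinEquiv_symm_apply_castAdd, Fin.append_left, Sum.elim_inl,
      Matrix.mulVecLin_apply, Matrix.mulVec_single_one]
    rfl
  · rw [finSumFinEquiv_symm_apply_natAdd, Fin.append_right, Sum.elim_inr,
      Matrix.mulVecLin_apply, Matrix.mulVec_single_one]
    rfl
end

section
/- Let h₁, h₂, k be positive integers with h₁ < k, h₂ < k and k ≤ h₁ + h₂ + 1; set i = h₁ + h₂ + 1 − k and fix s₁, s₂ ≥ 0 with (s₁+1) + (s₂+1) = i, and set αⱼ = hⱼ − sⱼ (so α₁ + α₂ = k + 1). Let A_c be the (h₁+1)×(k+1) matrix [I_{h₁+1} | 0] and let B_c be the (h₂+1)×(k+1) block matrix [[I_i, 0_{i,k−h₂}, 0_{i,k−h₁}], [0_{k−h₁,i}, 0_{k−h₁,k−h₂}, I_{k−h₁}]] (note h₂ + 1 = i + (k − h₁)). For subsets I ⊆ {1,…,h₁+1} with |I|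 = s₁+1 and J ⊆ {1,…,h₂+1} with |J| = s₂+1, let m(I,J) be the determinant of the (k+1)×(k+1) matrix whose first α₁ columns are the columns of A_cᵀ indexed by the complement of I (in increasing order) and whose last α₂ columns are the columns of B_cᵀ indexed by the complement of J (in increasing order). Then m(I,J) ≠ 0 if and only if I ⊆ {1,…,i}, J ⊆ {1,…,i} and J = {1,…,i} \ I; moreover every nonzero m(I,J) equals 1 or −1. Consequently the bifocal Grassmann tensor 𝔉_c of the canonical pair (A_c, B_c) has exactly binom(i, s₁+1) nonzero entries, each of absolute value 1, which gives a decomposition of 𝔉_c as a sum of binom(i, s₁+1) = rank(𝔉_c) rank-one (decomposable) tensors. -/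
open Matrix

lemma det_aux (n : ℕ) (f : Fin n → ℕ) (hf : ∀ c, f c < n) (M : Matrix (Fin n) (Fin n) ℂ)
    (hM : ∀ r c, M r c = if (r : ℕ) = f c then 1 else 0) :
    (M.det ≠ 0 ↔ Function.Injective f) ∧ (M.det ≠ 0 → M.det = 1 ∨ M.det = -1) := by
  by_cases h : Function.Injective f
  · have hg : Function.Injective (fun c => (⟨f c, hf c⟩ : Fin n)) := by
      intro a b hab
      exact h (by simpa using hab)
    let σ : Equiv.Perm (Fin n) := Equiv.ofBijective _ (Finite.injective_iff_bijective.1 hg)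
    have hMσ : M = (1 : Matrix (Fin n) (Fin n) ℂ).submatrix id σ := by
      ext r c
      rw [hM, Matrix.submatrix_apply, Matrix.one_apply]
      simp [σ, Fin.ext_iff]
    have hd : M.det = ((Equiv.Perm.sign σ : ℤ) : ℂ) := by
      rw [hMσ, Matrix.det_permute']
      simp
    have h1 : M.det = 1 ∨ M.det = -1 := by
      rw [hd]
      rcases Int.units_eq_one_or (Equiv.Perm.sign σ) with h | h <;> simp [h]
    refine ⟨⟨fun _ => h, fun _ => ?_⟩, fun _ => h1⟩
    rcases h1 with h1 | h1 <;> simp [h1]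
  · have : M.det = 0 := by
      rw [Function.Injective] at h
      push Not at h
      obtain ⟨a, b, hab, hne⟩ := h
      exact Matrix.det_zero_of_column_eq hne (fun r => by rw [hM, hM, hab])
    simp [this, h]

lemma comb_aux (A B : Finset ℕ) (a b i : ℕ) (hA : A.card = a) (hB : B.card = b)
    (hi : a + b = i) :
    (∀ n < i, n ∈ A ∨ n ∈ B) ↔
      ((∀ x ∈ A, x < i) ∧ (∀ x ∈ B, x < i) ∧ B = Finset.range i \ A) := by
  constructor
  · intro h
    have hsub : Finset.range i ⊆ A ∪ B := by
      intro n hn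
      simpa using h n (by simpa using hn)
    have hle : (A ∪ B).card ≤ (Finset.range i).card := by
      have := Finset.card_union_le A B
      simp; omega
    have heq := Finset.eq_of_subset_of_card_le hsub hle
    have hc := Finset.card_union_add_card_inter A B
    rw [← heq, Finset.card_range] at hc
    have h0 : A ∩ B = ∅ := Finset.card_eq_zero.1 (by omega)
    have hd : ∀ x, x ∈ A → x ∈ B → False := by
      intro x h1 h2
      have : x ∈ A ∩ B := Finset.mem_inter.2 ⟨h1, h2⟩
      simp [h0] at this
    have hm : ∀ x, x < i ↔ x ∈ A ∨ x ∈ B := by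
      intro x
      rw [← Finset.mem_range, heq, Finset.mem_union]
    refine ⟨fun x hx => (hm x).2 (Or.inl hx), fun x hx => (hm x).2 (Or.inr hx), ?_⟩
    ext x
    have := hm x
    have := hd x
    simp only [Finset.mem_sdiff, Finset.mem_range]
    tauto
  · rintro ⟨-, -, h⟩ n hn
    rw [h]
    simp only [Finset.mem_sdiff, Finset.mem_range]
    tauto

lemma count_aux (p q a b i : ℕ) (hp : i ≤ p) (hq : i ≤ q) (hi : a + b = i)
    (P : {I : Finset (Fin p) // I.card = a} × {J : Finset (Fin q) // J.card = b} → Prop)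
    (hP : ∀ x, P x ↔ ((∀ y ∈ x.1.1, (y : ℕ) < i) ∧ (∀ y ∈ x.2.1, (y : ℕ) < i) ∧
      x.2.1.image Fin.val = Finset.range i \ x.1.1.image Fin.val)) :
    Nat.card {x // P x} = Nat.choose i a := by
  have hr : Nat.card (Finset.powersetCard a (Finset.range i)) = Nat.choose i a := by
    rw [Nat.card_eq_fintype_card, Fintype.card_coe, Finset.card_powersetCard, Finset.card_range]
  have key : ∀ (n : ℕ) (S : Finset ℕ), i ≤ n → S ⊆ Finset.range i →
      (Finset.univ.filter (fun y : Fin n => (y : ℕ) ∈ S)).image Fin.val = S := by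
    intro n S hn hS
    ext z
    simp only [Finset.mem_image, Finset.mem_filter, Finset.mem_univ, true_and]
    constructor
    · rintro ⟨y, hy, rfl⟩
      exact hy
    · intro hz
      have := Finset.mem_range.1 (hS hz)
      exact ⟨⟨z, by omega⟩, hz, rfl⟩
  have keyc : ∀ (n : ℕ) (S : Finset ℕ), i ≤ n → S ⊆ Finset.range i →
      (Finset.univ.filter (fun y : Fin n => (y : ℕ) ∈ S)).card = S.card := by
    intro n S hn hS
    conv_rhs => rw [← key n S hn hS]
    rw [Finset.card_image_of_injective _ Fin.val_injective]
  rw [← hr]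
  refine Nat.card_eq_of_bijective (fun x => ⟨x.1.1.1.image Fin.val, ?_⟩) ⟨?_, ?_⟩
  · rw [Finset.mem_powersetCard, Finset.card_image_of_injective _ Fin.val_injective]
    refine ⟨?_, x.1.1.2⟩
    intro z hz
    obtain ⟨y, hy, rfl⟩ := Finset.mem_image.1 hz
    exact Finset.mem_range.2 (((hP _).1 x.2).1 y hy)
  · rintro ⟨x, hx⟩ ⟨y, hy⟩ hxy
    have h1 : x.1.1.image Fin.val = y.1.1.image Fin.val := by simpa using hxy
    have h2 : x.2.1.image Fin.val = y.2.1.image Fin.val := by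
      rw [((hP _).1 hx).2.2, ((hP _).1 hy).2.2, h1]
    have e1 := Finset.image_injective Fin.val_injective h1
    have e2 := Finset.image_injective Fin.val_injective h2
    exact Subtype.ext (Prod.ext (Subtype.ext e1) (Subtype.ext e2))
  · rintro ⟨S, hS⟩
    rw [Finset.mem_powersetCard] at hS
    have hT : Finset.range i \ S ⊆ Finset.range i := Finset.sdiff_subset
    refine ⟨⟨⟨⟨Finset.univ.filter (fun y : Fin p => (y : ℕ) ∈ S), ?_⟩,
      ⟨Finset.univ.filter (fun y : Fin q => (y : ℕ) ∈ Finset.range i \ S), ?_⟩⟩, ?_⟩, ?_⟩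
    · rw [keyc p S hp hS.1, hS.2]
    · rw [keyc q _ hq hT, Finset.card_sdiff_of_subset hS.1, hS.2, Finset.card_range]
      omega
    · rw [hP]
      refine ⟨?_, ?_, ?_⟩
      · intro y hy
        exact Finset.mem_range.1 (hS.1 (Finset.mem_filter.1 hy).2)
      · intro y hy
        exact Finset.mem_range.1 (hT (Finset.mem_filter.1 hy).2)
      · rw [key q _ hq hT, key p S hp hS.1]
    · exact Subtype.ext (key p S hp hS.1)

/-- For the canonical pair of projection matrices `(A_c, B_c)`, the entry
`m(I,J)` of the bifocal Grassmann tensor is nonzero iff `I ⊆ {0,…,i-1}`,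
`J ⊆ {0,…,i-1}` and (the set of values of) `J` is the complement of (that of) `I` inside
`{0,…,i-1}` (here `i = h₁+h₂+1-k`); every nonzero entry is `±1`; consequently the tensor
`𝔉_c` has exactly `binom(i, s₁+1)` nonzero entries, each of absolute value `1`. -/
theorem canonical_tensor_entries
    (h₁ h₂ k s₁ s₂ : ℕ) (hh₁ : 0 < h₁) (hh₂ : 0 < h₂)
    (hk1 : h₁ < k) (hk2 : h₂ < k) (hk3 : k ≤ h₁ + h₂ + 1)
    (hi : (s₁ + 1) + (s₂ + 1) = h₁ + h₂ + 1 - k)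
    (Ac : Matrix (Fin (h₁ + 1)) (Fin (k + 1)) ℂ)
    (hAc : Ac = Matrix.of fun (r : Fin (h₁ + 1)) (c : Fin (k + 1)) =>
      if (r : ℕ) = (c : ℕ) then 1 else 0)
    (Bc : Matrix (Fin (h₂ + 1)) (Fin (k + 1)) ℂ)
    (hBc : Bc = Matrix.of fun (r : Fin (h₂ + 1)) (c : Fin (k + 1)) =>
      if ((r : ℕ) = (c : ℕ) ∧ (r : ℕ) < h₁ + h₂ + 1 - k)
          ∨ ((c : ℕ) = (r : ℕ) + (k - h₂) ∧ h₁ + h₂ + 1 - k ≤ (r : ℕ)) then 1 else 0)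
    (m : {I : Finset (Fin (h₁ + 1)) // I.card = s₁ + 1} →
         {J : Finset (Fin (h₂ + 1)) // J.card = s₂ + 1} → ℂ)
    (hm : ∀ (I : {I : Finset (Fin (h₁ + 1)) // I.card = s₁ + 1})
            (J : {J : Finset (Fin (h₂ + 1)) // J.card = s₂ + 1}),
      m I J = Matrix.det (Matrix.of fun (r c : Fin (k + 1)) =>
        Sum.elim
          (fun a : Fin (h₁ - s₁) => Acᵀ r ((I.1ᶜ).orderEmbOfFin
            (by rw [Finset.card_compl, I.2, Fintype.card_fin]; omega) a))
          (fun b : Fin (h₂ - s₂) => Bcᵀ r ((J.1ᶜ).orderEmbOfFin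
            (by rw [Finset.card_compl, J.2, Fintype.card_fin]; omega) b))
          ((finCongr (by omega : (h₁ - s₁) + (h₂ - s₂) = k + 1).symm).trans
            finSumFinEquiv.symm c))) :
    (∀ I J, m I J ≠ 0 ↔
        ((∀ x ∈ I.1, (x : ℕ) < h₁ + h₂ + 1 - k) ∧
          (∀ y ∈ J.1, (y : ℕ) < h₁ + h₂ + 1 - k) ∧
          J.1.image Fin.val =
            Finset.range (h₁ + h₂ + 1 - k) \ I.1.image Fin.val)) ∧
    (∀ I J, m I J ≠ 0 → m I J = 1 ∨ m I J = -1) ∧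
    Nat.card {p : {I : Finset (Fin (h₁ + 1)) // I.card = s₁ + 1} ×
                  {J : Finset (Fin (h₂ + 1)) // J.card = s₂ + 1} // m p.1 p.2 ≠ 0}
      = Nat.choose (h₁ + h₂ + 1 - k) (s₁ + 1) := by
  have main : ∀ I J, (m I J ≠ 0 ↔
        ((∀ x ∈ I.1, (x : ℕ) < h₁ + h₂ + 1 - k) ∧
          (∀ y ∈ J.1, (y : ℕ) < h₁ + h₂ + 1 - k) ∧
          J.1.image Fin.val =
            Finset.range (h₁ + h₂ + 1 - k) \ I.1.image Fin.val)) ∧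
      (m I J ≠ 0 → m I J = 1 ∨ m I J = -1) := by
    intro I J
    have cI : (I.1ᶜ).card = h₁ - s₁ := by
      rw [Finset.card_compl, I.2, Fintype.card_fin]; omega
    have cJ : (J.1ᶜ).card = h₂ - s₂ := by
      rw [Finset.card_compl, J.2, Fintype.card_fin]; omega
    let e := (finCongr (by omega : (h₁ - s₁) + (h₂ - s₂) = k + 1).symm).trans
            finSumFinEquiv.symm
    let φ : ℕ → ℕ := fun y => if y < h₁ + h₂ + 1 - k then y else y + (k - h₂)
    let g : Fin (h₁ - s₁) ⊕ Fin (h₂ - s₂) → ℕ := Sum.elim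
      (fun a => ((I.1ᶜ).orderEmbOfFin cI a : ℕ)) (fun b => φ ((J.1ᶜ).orderEmbOfFin cJ b : ℕ))
    have hφ : Function.Injective φ := by
      intro a b hab
      simp only [φ] at hab
      split_ifs at hab <;> omega
    have hg : ∀ c, g c < k + 1 := by
      rintro (a | b)
      · have := ((I.1ᶜ).orderEmbOfFin cI a).isLt
        simp only [g, Sum.elim_inl]
        omega
      · have := ((J.1ᶜ).orderEmbOfFin cJ b).isLt
        simp only [g, Sum.elim_inr, φ]
        split_ifs <;> omega
    obtain ⟨hd1, hd2⟩ := det_aux (k + 1) (fun c => g (e c)) (fun c => hg _) (Matrix.of fun (r c : Fin (k + 1)) =>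
        Sum.elim
          (fun a : Fin (h₁ - s₁) => Acᵀ r ((I.1ᶜ).orderEmbOfFin cI a))
          (fun b : Fin (h₂ - s₂) => Bcᵀ r ((J.1ᶜ).orderEmbOfFin cJ b))
          (e c)) (by
        intro r c
        rw [Matrix.of_apply]
        rcases e c with a | b
        · simp only [Sum.elim_inl, g, hAc, Matrix.transpose_apply, Matrix.of_apply]
          congr 1
          exact propext eq_comm
        · simp only [Sum.elim_inr, g, hBc, Matrix.transpose_apply, Matrix.of_apply, φ]
          congr 1
          apply propext
          split_ifs <;> omega)
    rw [← hm I J] at hd1 hd2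
    refine ⟨?_, hd2⟩
    rw [hd1]
    have hinj : Function.Injective (fun c => g (e c)) ↔ Function.Injective g :=
      Function.Injective.of_comp_iff' g e.bijective
    have hcomb := comb_aux (I.1.image Fin.val) (J.1.image Fin.val) (s₁ + 1) (s₂ + 1)
      (h₁ + h₂ + 1 - k)
      (by rw [Finset.card_image_of_injective _ Fin.val_injective, I.2])
      (by rw [Finset.card_image_of_injective _ Fin.val_injective, J.2]) hi
    rw [Finset.forall_mem_image, Finset.forall_mem_image] at hcomb
    rw [hinj, ← hcomb]
    constructor
    · intro hgi n hn
      by_contra hcon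
      push Not at hcon
      obtain ⟨n1, n2⟩ := hcon
      have l1 : n < h₁ + 1 := by omega
      have l2 : n < h₂ + 1 := by omega
      have m1 : (⟨n, l1⟩ : Fin (h₁ + 1)) ∈ I.1ᶜ := by
        rw [Finset.mem_compl]
        exact fun h => n1 (Finset.mem_image.2 ⟨_, h, rfl⟩)
      have m2 : (⟨n, l2⟩ : Fin (h₂ + 1)) ∈ J.1ᶜ := by
        rw [Finset.mem_compl]
        exact fun h => n2 (Finset.mem_image.2 ⟨_, h, rfl⟩)
      rw [← Finset.mem_coe, ← Finset.range_orderEmbOfFin _ cI] at m1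
      rw [← Finset.mem_coe, ← Finset.range_orderEmbOfFin _ cJ] at m2
      obtain ⟨a, ha⟩ := m1
      obtain ⟨b, hb⟩ := m2
      have : g (Sum.inl a) = g (Sum.inr b) := by
        simp only [g, Sum.elim_inl, Sum.elim_inr, ha, hb, φ, if_pos hn]
      exact Sum.inl_ne_inr (hgi this)
    · intro hcov
      have cross : ∀ a b, g (Sum.inl a) ≠ g (Sum.inr b) := by
        intro a b hab
        have m1 := (I.1ᶜ).orderEmbOfFin_mem cI a
        have m2 := (J.1ᶜ).orderEmbOfFin_mem cJ b
        simp only [g, Sum.elim_inl, Sum.elim_inr, φ] at hab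
        generalize (I.1ᶜ).orderEmbOfFin cI a = x at *
        generalize (J.1ᶜ).orderEmbOfFin cJ b = y at *
        rw [Finset.mem_compl] at m1 m2
        split_ifs at hab with hy
        · rcases hcov y hy with h | h
          · obtain ⟨z, hz, hzy⟩ := Finset.mem_image.1 h
            exact m1 (by rwa [show x = z from Fin.ext (by omega)])
          · obtain ⟨z, hz, hzy⟩ := Finset.mem_image.1 h
            exact m2 (by rwa [show y = z from Fin.ext (by omega)])
        · have := x.isLt
          omega
      rintro (a | a) (b | b) hab
      · have : a = b := ((I.1ᶜ).orderEmbOfFin cI).injective (Fin.ext hab)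
        rw [this]
      · exact absurd hab (cross a b)
      · exact absurd hab.symm (cross b a)
      · have : a = b := ((J.1ᶜ).orderEmbOfFin cJ).injective (Fin.ext (hφ hab))
        rw [this]
  refine ⟨fun I J => (main I J).1, fun I J => (main I J).2, ?_⟩
  exact count_aux (h₁ + 1) (h₂ + 1) (s₁ + 1) (s₂ + 1) (h₁ + h₂ + 1 - k) (by omega) (by omega) hi
    (fun p => m p.1 p.2 ≠ 0) (fun p => (main p.1 p.2).1)
end

section
/- Let h₁, h₂, k be positive integers with k ≤ h₁ + h₂ + 1, fix s₁, s₂ ≥ 0 with (s₁+1)+(s₂+1) = h₁+h₂+1−k and set αⱼ = hⱼ − sⱼ (so α₁ + α₂ = k + 1). For a pair of complex matrices M₁ of size (k+1)×(h₁+1) and M₂ of size (k+1)×(h₂+1), define F(M₁,M₂) to be the matrix indexed by pairs (I, J), where I ⊆ {1,…,h₁+1} with |I| = s₁+1 and J ⊆ {1,…,h₂+1} with |J| = s₂+1, whose (I,J)-entry is the determinant of the (k+1)×(k+1) matrix formed by the columns of M₁ indexed by the complement of I (in increasing order) followed by the columns of M₂ indexed by the complement of J (in increasing order). Then for all G ∈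 GL(k+1, ℂ), K₁ ∈ GL(h₁+1, ℂ), K₂ ∈ GL(h₂+1, ℂ): F(G·M₁·K₁, G·M₂·K₂)(I,J) = det(G) · ∑_{L ⊆ {1,…,h₁+1}, |L| = α₁} ∑_{L′ ⊆ {1,…,h₂+1}, |L′| = α₂} det(K₁[L, Iᶜ]) · det(K₂[L′, Jᶜ]) · F(M₁,M₂)(Lᶜ, L′ᶜ). -/
open Matrix

/-- The bifocal Grassmann tensor (generalized fundamental matrix, up to entrywise signs)
of a pair of matrices `M₁ : (k+1)×(h₁+1)`, `M₂ : (k+1)×(h₂+1)`: the `(I,J)`-entry is the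
determinant of the `(k+1)×(k+1)` matrix formed by the columns of `M₁` indexed by the
complement of `I` (in increasing order) followed by the columns of `M₂` indexed by the
complement of `J` (in increasing order). Here `α₁ = h₁ - s₁` and `α₂ = h₂ - s₂`. -/
noncomputable def bifocalTensor (k h₁ h₂ s₁ s₂ : ℕ)
    (hsum : (h₁ - s₁) + (h₂ - s₂) = k + 1)
    (M₁ : Matrix (Fin (k + 1)) (Fin (h₁ + 1)) ℂ)
    (M₂ : Matrix (Fin (k + 1)) (Fin (h₂ + 1)) ℂ)
    (I : {I : Finset (Fin (h₁ + 1)) // I.card = s₁ + 1})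
    (J : {J : Finset (Fin (h₂ + 1)) // J.card = s₂ + 1}) : ℂ :=
  Matrix.det (Matrix.of fun (r c : Fin (k + 1)) =>
    Sum.elim
      (fun a : Fin (h₁ - s₁) => M₁ r ((I.1ᶜ).orderEmbOfFin
        (by rw [Finset.card_compl, I.2, Fintype.card_fin]; omega) a))
      (fun b : Fin (h₂ - s₂) => M₂ r ((J.1ᶜ).orderEmbOfFin
        (by rw [Finset.card_compl, J.2, Fintype.card_fin]; omega) b))
      ((finCongr hsum.symm).trans finSumFinEquiv.symm c))

namespace BifocalAux

variable {V : Type*} [AddCommGroup V] [Module ℂ V]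

/-- Cauchy–Binet type expansion for alternating maps. -/
theorem expand {a n : ℕ} (f : V [⋀^Fin a]→ₗ[ℂ] ℂ) (v : Fin n → V)
    (K : Matrix (Fin n) (Fin a) ℂ) :
    f (fun c => ∑ i, K i c • v i)
      = ∑ L : {L : Finset (Fin n) // L.card = a},
          (K.submatrix (L.1.orderEmbOfFin L.2) id).det * f (fun c => v (L.1.orderEmbOfFin L.2 c)) := by
  classical
  have h1 : f (fun c => ∑ i, K i c • v i)
      = ∑ p : Fin a → Fin n, (∏ c, K (p c) c) * f (fun c => v (p c)) := by
    have := f.toMultilinearMap.map_sum (fun (c : Fin a) (i : Fin n) => K i c • v i)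
    refine this.trans (Finset.sum_congr rfl fun p _ => ?_)
    exact f.toMultilinearMap.map_smul_univ (fun c => K (p c) c) (fun c => v (p c))
  rw [h1]
  have h2 : ∀ L : {L : Finset (Fin n) // L.card = a},
      (K.submatrix (L.1.orderEmbOfFin L.2) id).det * f (fun c => v (L.1.orderEmbOfFin L.2 c))
      = ∑ σ : Equiv.Perm (Fin a), (∏ c, K (L.1.orderEmbOfFin L.2 (σ c)) c)
          * f (fun c => v (L.1.orderEmbOfFin L.2 (σ c))) := by
    intro L
    rw [Matrix.det_apply', Finset.sum_mul]
    refine Finset.sum_congr rfl fun σ _ => ?_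
    have := f.map_perm (fun c => v (L.1.orderEmbOfFin L.2 c)) σ
    have h3 : f (fun c => v (L.1.orderEmbOfFin L.2 (σ c))) = _ := this
    rw [h3]
    simp only [Matrix.submatrix_apply, id, Units.smul_def, zsmul_eq_mul]
    ring
  rw [Finset.sum_congr rfl fun L _ => h2 L, ← Finset.sum_product', Finset.univ_product_univ]
  symm
  refine Finset.sum_of_injOn (fun q c => q.1.1.orderEmbOfFin q.1.2 (q.2 c)) ?_ ?_ ?_ ?_
  · rintro ⟨⟨L, hL⟩, σ⟩ - ⟨⟨L', hL'⟩, σ'⟩ - h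
    have hr : ∀ (L : Finset (Fin n)) (hL : L.card = a) (σ : Equiv.Perm (Fin a)),
        Set.range (fun c => L.orderEmbOfFin hL (σ c)) = L := by
      intro L hL σ
      have := σ.surjective.range_comp (L.orderEmbOfFin hL)
      rw [Finset.range_orderEmbOfFin] at this
      exact this
    have hLL : L = L' := by
      have h4 := hr L hL σ
      have h5 := hr L' hL' σ'
      simp only at h
      rw [h, h5] at h4
      exact_mod_cast h4.symm
    subst hLL
    have : σ = σ' := by
      ext c
      have := congrFun h c
      simp only at this
      rw [(L.orderEmbOfFin hL).injective this]
    rw [this]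
  · intro _ _; simp
  · intro p _ hp
    by_cases hinj : Function.Injective p
    · exfalso
      apply hp
      have hc : (Finset.univ.image p).card = a := by
        rw [Finset.card_image_of_injective _ hinj, Finset.card_univ, Fintype.card_fin]
      have hex : ∀ c, ∃ d, (Finset.univ.image p).orderEmbOfFin hc d = p c := by
        intro c
        have : p c ∈ Set.range ((Finset.univ.image p).orderEmbOfFin hc) := by
          rw [Finset.range_orderEmbOfFin]; simp
        exact this
      choose s hs using hex
      have sinj : Function.Injective s := by
        intro x y hxy
        apply hinj
        rw [← hs x, ← hs y, hxy]
      refine ⟨(⟨_, hc⟩, Equiv.ofBijective s (Finite.injective_iff_bijective.mp sinj)), by simp, ?_⟩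
      funext c
      exact hs c
    · have : f (fun c => v (p c)) = 0 := by
        obtain ⟨x, y, hxy, hne⟩ : ∃ x y, p x = p y ∧ x ≠ y := by
          simpa [Function.Injective] using hinj
        exact f.map_eq_zero_of_eq _ (by simp [hxy]) hne
      rw [this, mul_zero]
  · intro _ _; rfl

/-- Fix the right block of arguments. -/
def fixR {ι κ : Type*} (g : V [⋀^(ι ⊕ κ)]→ₗ[ℂ] ℂ) (w : κ → V) : V [⋀^ι]→ₗ[ℂ] ℂ where
  toFun v := g (Sum.elim v w)
  map_update_add' := by
    classical
    intro d v i x y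
    have := Subsingleton.elim d (Classical.decEq ι)
    subst this
    simp only [← Sum.update_elim_inl]
    exact g.map_update_add _ _ _ _
  map_update_smul' := by
    classical
    intro d v i c x
    have := Subsingleton.elim d (Classical.decEq ι)
    subst this
    simp only [← Sum.update_elim_inl]
    exact g.map_update_smul _ _ _ _
  map_eq_zero_of_eq' := by
    intro v i j h hij
    exact g.map_eq_zero_of_eq (i := Sum.inl i) (j := Sum.inl j) _ (by simpa using h) (by simpa using hij)

/-- Fix the left block of arguments. -/
def fixL {ι κ : Type*} (g : V [⋀^(ι ⊕ κ)]→ₗ[ℂ] ℂ) (v : ι → V) : V [⋀^κ]→ₗ[ℂ] ℂ where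
  toFun w := g (Sum.elim v w)
  map_update_add' := by
    classical
    intro d w i x y
    have := Subsingleton.elim d (Classical.decEq κ)
    subst this
    simp only [← Sum.update_elim_inr]
    exact g.map_update_add _ _ _ _
  map_update_smul' := by
    classical
    intro d w i c x
    have := Subsingleton.elim d (Classical.decEq κ)
    subst this
    simp only [← Sum.update_elim_inr]
    exact g.map_update_smul _ _ _ _
  map_eq_zero_of_eq' := by
    intro w i j h hij
    exact g.map_eq_zero_of_eq (i := Sum.inr i) (j := Sum.inr j) _ (by simpa using h) (by simpa using hij)

theorem expand₂ {a b n m : ℕ} (g : V [⋀^(Fin a ⊕ Fin b)]→ₗ[ℂ] ℂ) (v : Fin n → V) (w : Fin m → V)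
    (K : Matrix (Fin n) (Fin a) ℂ) (K' : Matrix (Fin m) (Fin b) ℂ) :
    g (Sum.elim (fun c => ∑ i, K i c • v i) (fun c => ∑ i, K' i c • w i))
      = ∑ L : {L : Finset (Fin n) // L.card = a}, ∑ L' : {L : Finset (Fin m) // L.card = b},
          (K.submatrix (L.1.orderEmbOfFin L.2) id).det *
          (K'.submatrix (L'.1.orderEmbOfFin L'.2) id).det *
          g (Sum.elim (fun c => v (L.1.orderEmbOfFin L.2 c))
            (fun c => w (L'.1.orderEmbOfFin L'.2 c))) := by
  refine (expand (fixR g (fun c => ∑ i, K' i c • w i)) v K).trans ?_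
  refine Finset.sum_congr rfl fun L _ => ?_
  have := expand (fixL g (fun c => v (L.1.orderEmbOfFin L.2 c))) w K'
  refine (congrArg _ this).trans ?_
  rw [Finset.mul_sum]
  refine Finset.sum_congr rfl fun L' _ => ?_
  rw [mul_assoc]
  rfl

/-- The determinant with split column index. -/
noncomputable def detS {a b k : ℕ} (h : a + b = k + 1) :
    (Fin (k + 1) → ℂ) [⋀^(Fin a ⊕ Fin b)]→ₗ[ℂ] ℂ :=
  (Matrix.detRowAlternating (n := Fin (k + 1)) (R := ℂ)).domDomCongr
    ((finCongr h.symm).trans finSumFinEquiv.symm)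

theorem bifocal_eq (k h₁ h₂ s₁ s₂ : ℕ)
    (hsum : (h₁ - s₁) + (h₂ - s₂) = k + 1)
    (M₁ : Matrix (Fin (k + 1)) (Fin (h₁ + 1)) ℂ)
    (M₂ : Matrix (Fin (k + 1)) (Fin (h₂ + 1)) ℂ)
    (I : {I : Finset (Fin (h₁ + 1)) // I.card = s₁ + 1})
    (J : {J : Finset (Fin (h₂ + 1)) // J.card = s₂ + 1}) :
    bifocalTensor k h₁ h₂ s₁ s₂ hsum M₁ M₂ I J
      = detS hsum (Sum.elim
        (fun a => M₁ᵀ ((I.1ᶜ).orderEmbOfFin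
          (by rw [Finset.card_compl, I.2, Fintype.card_fin]; omega) a))
        (fun b => M₂ᵀ ((J.1ᶜ).orderEmbOfFin
          (by rw [Finset.card_compl, J.2, Fintype.card_fin]; omega) b))) := by
  unfold bifocalTensor
  rw [← Matrix.det_transpose]
  change _ = Matrix.det _
  congr 1
  ext c r
  simp only [Matrix.transpose_apply, Matrix.of_apply, Function.comp_apply]
  generalize ((finCongr hsum.symm).trans finSumFinEquiv.symm) c = x
  cases x <;> rfl

theorem bifocal_G (k h₁ h₂ s₁ s₂ : ℕ)
    (hsum : (h₁ - s₁) + (h₂ - s₂) = k + 1)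
    (G : Matrix (Fin (k + 1)) (Fin (k + 1)) ℂ)
    (M₁ : Matrix (Fin (k + 1)) (Fin (h₁ + 1)) ℂ)
    (M₂ : Matrix (Fin (k + 1)) (Fin (h₂ + 1)) ℂ)
    (I : {I : Finset (Fin (h₁ + 1)) // I.card = s₁ + 1})
    (J : {J : Finset (Fin (h₂ + 1)) // J.card = s₂ + 1}) :
    bifocalTensor k h₁ h₂ s₁ s₂ hsum (G * M₁) (G * M₂) I J
      = G.det * bifocalTensor k h₁ h₂ s₁ s₂ hsum M₁ M₂ I J := by
  unfold bifocalTensor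
  rw [← Matrix.det_mul]
  congr 1
  ext r c
  simp only [Matrix.mul_apply, Matrix.of_apply]
  generalize ((finCongr hsum.symm).trans finSumFinEquiv.symm) c = x
  cases x <;> rfl

theorem emb_cc {n a : ℕ} (L : Finset (Fin n)) (h : L.card = a) (h' : (Lᶜᶜ).card = a) :
    (Lᶜᶜ).orderEmbOfFin h' = L.orderEmbOfFin h := by
  simp only [compl_compl]

end BifocalAux

/-- Transformation law for bifocal Grassmann tensors under the action
`[M₁ | M₂] ↦ [G·M₁·K₁ | G·M₂·K₂]` of `GL(k+1) × GL(h₁+1) × GL(h₂+1)`. -/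
theorem bifocalTensor_transformation
    (h₁ h₂ k s₁ s₂ : ℕ) (hh₁ : 0 < h₁) (hh₂ : 0 < h₂) (hk : 0 < k)
    (hk3 : k ≤ h₁ + h₂ + 1)
    (hi : (s₁ + 1) + (s₂ + 1) = h₁ + h₂ + 1 - k)
    (hs₁ : s₁ ≤ h₁) (hs₂ : s₂ ≤ h₂)
    (M₁ : Matrix (Fin (k + 1)) (Fin (h₁ + 1)) ℂ)
    (M₂ : Matrix (Fin (k + 1)) (Fin (h₂ + 1)) ℂ)
    (G : Matrix (Fin (k + 1)) (Fin (k + 1)) ℂ)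
    (K₁ : Matrix (Fin (h₁ + 1)) (Fin (h₁ + 1)) ℂ)
    (K₂ : Matrix (Fin (h₂ + 1)) (Fin (h₂ + 1)) ℂ)
    (hG : IsUnit G) (hK₁ : IsUnit K₁) (hK₂ : IsUnit K₂)
    (I : {I : Finset (Fin (h₁ + 1)) // I.card = s₁ + 1})
    (J : {J : Finset (Fin (h₂ + 1)) // J.card = s₂ + 1}) :
    bifocalTensor k h₁ h₂ s₁ s₂ (by omega) (G * M₁ * K₁) (G * M₂ * K₂) I J
      = G.det *
        ∑ L : {L : Finset (Fin (h₁ + 1)) // L.card = h₁ - s₁},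
          ∑ L' : {L' : Finset (Fin (h₂ + 1)) // L'.card = h₂ - s₂},
            (K₁.submatrix (L.1.orderEmbOfFin L.2)
              ((I.1ᶜ).orderEmbOfFin
                (by rw [Finset.card_compl, I.2, Fintype.card_fin]; omega))).det *
            (K₂.submatrix (L'.1.orderEmbOfFin L'.2)
              ((J.1ᶜ).orderEmbOfFin
                (by rw [Finset.card_compl, J.2, Fintype.card_fin]; omega))).det *
            bifocalTensor k h₁ h₂ s₁ s₂ (by omega) M₁ M₂
              ⟨L.1ᶜ, by rw [Finset.card_compl, L.2, Fintype.card_fin]; omega⟩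
              ⟨L'.1ᶜ, by rw [Finset.card_compl, L'.2, Fintype.card_fin]; omega⟩ := by
  rw [Matrix.mul_assoc, Matrix.mul_assoc, BifocalAux.bifocal_G]
  congr 1
  rw [BifocalAux.bifocal_eq]
  have hc : ∀ {n : ℕ} (M : Matrix (Fin (k + 1)) (Fin n) ℂ) (K : Matrix (Fin n) (Fin n) ℂ)
      (j : Fin n), (M * K)ᵀ j = ∑ i, K i j • Mᵀ i := by
    intro n M K j
    ext r
    simp [Matrix.mul_apply, mul_comm]
  simp only [hc]
  refine (BifocalAux.expand₂ _ M₁ᵀ M₂ᵀ (K₁.submatrix id _) (K₂.submatrix id _)).trans ?_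
  refine Finset.sum_congr rfl fun L _ => Finset.sum_congr rfl fun L' _ => ?_
  rw [BifocalAux.bifocal_eq]
  simp only [BifocalAux.emb_cc L.1 L.2, BifocalAux.emb_cc L'.1 L'.2, Matrix.submatrix_submatrix,
    Function.id_comp, Function.comp_id]
end
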